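/- Let S be a type of states, A a nonempty finite type of actions, b > 1, N ∈ ℕ, α ∈ ℝ, γ ∈ ℝ. Let (s_t, a_t, r_t, s'_t)_{t∈ℕ} be any sequence of transitions with |r_t| ≤ (b^{N+1} − 1)/(b − 1) for all t. Define the standard Q-learning iterates Q̂_t : S × A → ℝ by Q̂_0 = 0 and Q̂_{t+1}(s_t, a_t) = Q̂_t(s_t, a_t) + α(r_t + γ · max_{a'} Q̂_t(s'_t, a') − Q̂_t(s_t, a_t)), with Q̂_{t+1} = Q̂_t elsewhere. Define the Spectral Q-learning iterates Q_t : S × A × {0,…,N} → ℝ by Q_0 = 0 and, letting a'_t be any action maximizing a' ↦ ∑_{i=0}^{N} b^i Q_t(s'_t, a', i), Q_{t+1}(s_t, a_t, i) = Q_t(s_t, a_t, i) + α((r_t)_b^i + γ Q_t(s'_t, a'_t, i) − Q_t(s_t, a_t, i)) for each i, with Q_{t+1} = Q_t elsewhere. Then for every t, s, and a, the summed spectral action-values equal the standard action-values: ∑_{i=0}^{N} b^i Q_t(s, a, i) = Q̂_t(s, a). -/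

import Mathlib

/-- Clamp a real number to the interval [0, 1]. -/
noncomputable def clamp (x : ℝ) : ℝ := max 0 (min x 1)

/-- The `i`-th spectral component of the real number `r` to base `b`. -/
noncomputable def spec (b r : ℝ) (i : ℕ) : ℝ :=
  Real.sign r * clamp ((|r| - (b ^ i - 1) / (b - 1)) / b ^ i)

theorem clamp_sum (b : ℝ) (hb : 1 < b) (x : ℝ) (hx : 0 ≤ x) (n : ℕ) :
    ∑ i ∈ Finset.range n, b ^ i * clamp ((x - (b ^ i - 1) / (b - 1)) / b ^ i) =
      min x ((b ^ n - 1) / (b - 1)) := by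
  induction n with
  | zero => simp [hx]
  | succ n ih =>
    rw [Finset.sum_range_succ, ih]
    have hp : 0 < b ^ n := by positivity
    have hb1 : b - 1 ≠ 0 := by linarith
    have hc : (b ^ (n + 1) - 1) / (b - 1) = (b ^ n - 1) / (b - 1) + b ^ n := by
      field_simp
      ring
    rw [hc]
    generalize (b ^ n - 1) / (b - 1) = c
    generalize b ^ n = p at *
    have h : p * clamp ((x - c) / p) = max 0 (min (x - c) p) := by
      unfold clamp
      rw [mul_max_of_nonneg _ _ hp.le, mul_min_of_nonneg _ _ hp.le, mul_div_cancel₀ _ hp.ne']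
      simp
    rw [h]
    grind

theorem spec_sum (b : ℝ) (hb : 1 < b) (N : ℕ) (r : ℝ)
    (hr : |r| ≤ (b ^ (N + 1) - 1) / (b - 1)) :
    ∑ i : Fin (N + 1), b ^ (i : ℕ) * spec b r (i : ℕ) = r := by
  rw [Fin.sum_univ_eq_sum_range (fun i => b ^ i * spec b r i)]
  have h := clamp_sum b hb |r| (abs_nonneg r) (N + 1)
  rw [min_eq_left hr] at h
  have h2 : ∑ i ∈ Finset.range (N + 1), b ^ i * spec b r i = Real.sign r * |r| := by
    rw [← h, Finset.mul_sum]
    refine Finset.sum_congr rfl fun i _ => ?_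
    unfold spec
    ring
  rw [h2]
  rcases lt_trichotomy r 0 with h | h | h
  · rw [Real.sign_of_neg h, abs_of_neg h]; ring
  · simp [h]
  · rw [Real.sign_of_pos h, abs_of_pos h]; ring

/-- **Proposition 1.** In the tabular setting, Spectral Q-learning behaves identically to
standard Q-learning, provided the rewards are bounded in magnitude by
`(b^(N+1) - 1)/(b - 1)`: at every time step the summed spectral action-values coincide
with the standard Q-learning action-values. -/
theorem spectral_q_learning_eq_q_learning
    {S A : Type*} [Fintype A] [Nonempty A]
    (b : ℝ) (hb : 1 < b) (N : ℕ) (α γ : ℝ)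
    (s : ℕ → S) (a : ℕ → A) (r : ℕ → ℝ) (s' : ℕ → S)
    (hr : ∀ t, |r t| ≤ (b ^ (N + 1) - 1) / (b - 1))
    -- standard Q-learning iterates
    (Qhat : ℕ → S → A → ℝ)
    (hQhat0 : ∀ x u, Qhat 0 x u = 0)
    (hQhatUpd : ∀ t, Qhat (t + 1) (s t) (a t) =
        Qhat t (s t) (a t) +
          α * (r t +
              γ * (Finset.univ.sup' Finset.univ_nonempty (fun a' => Qhat t (s' t) a')) -
            Qhat t (s t) (a t)))
    (hQhatEq : ∀ t x u, (x, u) ≠ (s t, a t) → Qhat (t + 1) x u = Qhat t x u)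
    -- spectral Q-learning iterates
    (Q : ℕ → S → A → Fin (N + 1) → ℝ)
    (hQ0 : ∀ x u i, Q 0 x u i = 0)
    (a' : ℕ → A)
    (ha' : ∀ t a'', ∑ i : Fin (N + 1), b ^ (i : ℕ) * Q t (s' t) a'' i ≤
        ∑ i : Fin (N + 1), b ^ (i : ℕ) * Q t (s' t) (a' t) i)
    (hQUpd : ∀ t i, Q (t + 1) (s t) (a t) i =
        Q t (s t) (a t) i +
          α * (spec b (r t) (i : ℕ) + γ * Q t (s' t) (a' t) i - Q t (s t) (a t) i))
    (hQEq : ∀ t x u i, (x, u) ≠ (s t, a t) → Q (t + 1) x u i = Q t x u i) :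
    ∀ t x u, ∑ i : Fin (N + 1), b ^ (i : ℕ) * Q t x u i = Qhat t x u := by
  intro t
  induction t with
  | zero => intro x u; simp [hQ0, hQhat0]
  | succ t ih =>
    intro x u
    by_cases hxu : (x, u) = (s t, a t)
    · obtain ⟨rfl, rfl⟩ := Prod.mk.inj hxu
      have hsup : Finset.univ.sup' Finset.univ_nonempty (fun a' => Qhat t (s' t) a') =
          Qhat t (s' t) (a' t) := by
        apply le_antisymm
        · apply Finset.sup'_le
          intro v _
          rw [← ih, ← ih]
          exact ha' t v
        · exact Finset.le_sup' (fun a' => Qhat t (s' t) a') (Finset.mem_univ (a' t))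
      rw [hQhatUpd, hsup, ← ih, ← ih]
      conv_rhs => rw [← spec_sum b hb N (r t) (hr t)]
      simp only [hQUpd, Finset.mul_sum, ← Finset.sum_add_distrib, ← Finset.sum_sub_distrib]
      refine Finset.sum_congr rfl fun i _ => ?_
      ring
    · rw [hQhatEq t x u hxu, ← ih]
      simp only [hQEq t x u _ hxu]
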